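/- Let (E,j,s) be a split inductive system, i.e. (E,j) is a soft inductive system of Banach spaces and s : E_∞ → C(E,j) is a linear map with sup_n ‖s_n(y)‖ ≤ ‖y‖ for all y ∈ E_∞ which is a right inverse of j-lim (that is, j-lim_n s_n(y) = y for all y ∈ E_∞). Define new connecting maps j̃_{nm} : E_m → E_n by j̃_{nm}(x_m) := s_n(j_{∞m} x_m). Then (E, j̃) is a soft inductive system, the notions of j-convergence and j̃-convergence coincide (so both systems define the same limit space), and the j̃-maps satisfy the stronger uniform condition lim_m sup_n ‖(j̃_{nl} − j̃_{nm} ∘ j̃_{ml}) x_l‖ = 0 for every l ∈ N and x_l ∈ E_l. -/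

import Mathlib

open Filter Topology MeasureTheory

variable {N : Type*} [Preorder N] [IsDirected N (· ≤ ·)] [Nonempty N]
variable {E : N → Type*} [∀ n, NormedAddCommGroup (E n)] [∀ n, NormedSpace ℂ (E n)]
  [∀ n, CompleteSpace (E n)]

/-- A *soft inductive system* of Banach spaces over the directed set `N`:
linear contractions `j n m : E m → E n` (for `n ≥ m`, with `j n n = id` and
`j n m = 0` when `¬ m ≤ n`), satisfying
`lim_m limsup_n ‖(j n l - j n m ∘ j m l) x‖ = 0` for all `l` and `x : E l`. -/
structure IsSoftInductiveSystem (j : ∀ n m : N, E m →L[ℂ] E n) : Prop where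
  map_self : ∀ n, j n n = ContinuousLinearMap.id ℂ (E n)
  map_not_le : ∀ n m, ¬ m ≤ n → j n m = 0
  contraction : ∀ n m, m ≤ n → ∀ x : E m, ‖j n m x‖ ≤ ‖x‖
  soft : ∀ (l : N) (x : E l),
    Tendsto (fun m => limsup (fun n => ‖j n l x - j n m (j m l x)‖) atTop)
      atTop (𝓝 0)

/-- A net `x = (x n)_{n ∈ N}` (with `x n ∈ E n`) is uniformly bounded. -/
def UniformlyBounded (x : ∀ n, E n) : Prop := ∃ C : ℝ, ∀ n, ‖x n‖ ≤ C

/-- The seminorm `|‖x‖| = limsup_n ‖x n‖` on uniformly bounded nets. -/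
noncomputable def netSeminorm (x : ∀ n, E n) : ℝ := limsup (fun n => ‖x n‖) atTop

/-- The basic net `j_{• m} ξ` associated with `ξ ∈ E m`. -/
def basicNet (j : ∀ n m : N, E m →L[ℂ] E n) (m : N) (ξ : E m) : ∀ n, E n :=
  fun n => j n m ξ

/-- A uniformly bounded net is `j`-convergent if it lies in the seminorm-closure of
the set of basic nets. -/
def JConvergent (j : ∀ n m : N, E m →L[ℂ] E n) (x : ∀ n, E n) : Prop :=
  UniformlyBounded x ∧
    ∀ ε : ℝ, 0 < ε → ∃ (m : N) (ξ : E m), netSeminorm (fun n => x n - j n m ξ) < ε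

/-- A net is a null net if `lim_n ‖x n‖ = 0`. -/
def IsNullNet (x : ∀ n, E n) : Prop := Tendsto (fun n => ‖x n‖) atTop (𝓝 0)

/-- A realization `(G, L)` of the limit space `E_∞ = C(E,j)/C₀(E,j)` of a soft inductive
system: `L` sends a `j`-convergent net to its `j`-limit; it is linear on `j`-convergent
nets, the norm of a `j`-limit is the seminorm of the net, and every element of `G`
arises as a `j`-limit. -/
structure IsLimitSpace (j : ∀ n m : N, E m →L[ℂ] E n) (G : Type*)
    [NormedAddCommGroup G] [NormedSpace ℂ G] (L : (∀ n, E n) → G) : Prop where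
  map_add : ∀ x y, JConvergent j x → JConvergent j y → L (x + y) = L x + L y
  map_smul : ∀ (c : ℂ) (x), JConvergent j x → L (c • x) = c • L x
  norm_eq : ∀ x, JConvergent j x → ‖L x‖ = netSeminorm x
  surjective : ∀ g : G, ∃ x, JConvergent j x ∧ L x = g

section Auxiliary

set_option linter.unusedSectionVars false

/-- Basic nets are uniformly bounded by the norm of the generating vector. -/
theorem IsSoftInductiveSystem.norm_map_le {j : ∀ n m : N, E m →L[ℂ] E n}
    (hj : IsSoftInductiveSystem j) (n m : N) (ξ : E m) : ‖j n m ξ‖ ≤ ‖ξ‖ := by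
  by_cases h : m ≤ n
  · exact hj.contraction n m h ξ
  · simp [hj.map_not_le n m h]

theorem UniformlyBounded.add {x y : ∀ n, E n} (hx : UniformlyBounded x)
    (hy : UniformlyBounded y) : UniformlyBounded (fun n => x n + y n) := by
  obtain ⟨a, ha⟩ := hx
  obtain ⟨b, hb⟩ := hy
  exact ⟨a + b, fun n => norm_add_le_of_le (ha n) (hb n)⟩

theorem UniformlyBounded.sub {x y : ∀ n, E n} (hx : UniformlyBounded x)
    (hy : UniformlyBounded y) : UniformlyBounded (fun n => x n - y n) := by
  obtain ⟨a, ha⟩ := hx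
  obtain ⟨b, hb⟩ := hy
  exact ⟨a + b, fun n => norm_sub_le_of_le (ha n) (hb n)⟩

theorem UniformlyBounded.isBoundedUnder {x : ∀ n, E n} (hx : UniformlyBounded x) :
    IsBoundedUnder (· ≤ ·) atTop (fun n => ‖x n‖) :=
  let ⟨C, hC⟩ := hx
  isBoundedUnder_of ⟨C, hC⟩

theorem UniformlyBounded.eventually_norm_lt {x : ∀ n, E n} (hx : UniformlyBounded x) {ε : ℝ}
    (h : netSeminorm x < ε) : ∀ᶠ n in atTop, ‖x n‖ < ε :=
  eventually_lt_of_limsup_lt h hx.isBoundedUnder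

theorem isCoboundedUnder_norm (x : ∀ n, E n) :
    IsCoboundedUnder (· ≤ ·) atTop (fun n => ‖x n‖) :=
  (isBoundedUnder_of ⟨0, fun n => norm_nonneg (x n)⟩ :
    IsBoundedUnder (· ≥ ·) atTop (fun n => ‖x n‖)).isCoboundedUnder_le

theorem netSeminorm_le {x : ∀ n, E n} {ε : ℝ} (h : ∀ᶠ n in atTop, ‖x n‖ ≤ ε) :
    netSeminorm x ≤ ε :=
  limsup_le_of_le (isCoboundedUnder_norm x) h

theorem UniformlyBounded.netSeminorm_nonneg {x : ∀ n, E n} (hx : UniformlyBounded x) :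
    0 ≤ netSeminorm x :=
  le_limsup_of_frequently_le (Eventually.of_forall fun n => norm_nonneg (x n)).frequently
    hx.isBoundedUnder

theorem UniformlyBounded.isNullNet {x : ∀ n, E n} (hx : UniformlyBounded x)
    (h : netSeminorm x = 0) : IsNullNet x := by
  refine Metric.tendsto_nhds.2 fun ε hε => ?_
  filter_upwards [hx.eventually_norm_lt (h.trans_lt hε)] with n hn
  simpa using hn

namespace JConvergent

variable {j : ∀ n m : N, E m →L[ℂ] E n}

theorem basicNet (hj : IsSoftInductiveSystem j) (m : N) (ξ : E m) :
    JConvergent j (basicNet j m ξ) := by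
  refine ⟨⟨‖ξ‖, fun n => hj.norm_map_le n m ξ⟩, fun ε hε => ⟨m, ξ, ?_⟩⟩
  refine (netSeminorm_le (Eventually.of_forall fun n => ?_)).trans_lt hε
  simp [_root_.basicNet]

theorem neg_one_smul {x : ∀ n, E n} (hx : JConvergent j x) : JConvergent j ((-1 : ℂ) • x) := by
  obtain ⟨⟨C, hC⟩, h⟩ := hx
  refine ⟨⟨C, fun n => by simpa using hC n⟩, fun ε hε => ?_⟩
  obtain ⟨m, ξ, hξ⟩ := h ε hε
  refine ⟨m, -ξ, ?_⟩
  have : (fun n => ‖((-1 : ℂ) • x) n - j n m (-ξ)‖) = fun n => ‖x n - j n m ξ‖ := by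
    funext n
    rw [← norm_neg]
    congr 1
    simp [neg_add_eq_sub]
  rw [netSeminorm, this]
  exact hξ

theorem add (hj : IsSoftInductiveSystem j) {x y : ∀ n, E n} (hx : JConvergent j x)
    (hy : JConvergent j y) : JConvergent j (x + y) := by
  have bdd : ∀ (m : N) (ξ : E m), UniformlyBounded (fun n => j n m ξ) := fun m ξ =>
    (basicNet hj m ξ).1
  refine ⟨hx.1.add hy.1, fun ε hε => ?_⟩
  have hε' : 0 < ε / 5 := by positivity
  obtain ⟨l, ξ, hξ⟩ := hx.2 _ hε'
  obtain ⟨k, η, hη⟩ := hy.2 _ hε'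
  obtain ⟨m, hm₁, hm₂⟩ := (((hj.soft l ξ).eventually_lt_const hε').and
    ((hj.soft k η).eventually_lt_const hε')).exists
  refine ⟨m, j m l ξ + j m k η, ?_⟩
  refine lt_of_le_of_lt (netSeminorm_le (ε := 4 * (ε / 5)) ?_) (by linarith)
  filter_upwards [(hx.1.sub (bdd l ξ)).eventually_norm_lt hξ,
    (hy.1.sub (bdd k η)).eventually_norm_lt hη,
    ((bdd l ξ).sub (bdd m (j m l ξ))).eventually_norm_lt hm₁,
    ((bdd k η).sub (bdd m (j m k η))).eventually_norm_lt hm₂] with n h₁ h₂ h₃ h₄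
  have key : (x + y) n - j n m (j m l ξ + j m k η) = (x n - j n l ξ) + (y n - j n k η) +
      (j n l ξ - j n m (j m l ξ)) + (j n k η - j n m (j m k η)) := by
    simp only [Pi.add_apply, map_add]
    abel
  rw [key]
  refine norm_add₄_le.trans ?_
  linarith

theorem sub (hj : IsSoftInductiveSystem j) {x y : ∀ n, E n} (hx : JConvergent j x)
    (hy : JConvergent j y) : JConvergent j (x - y) := by
  simpa [sub_eq_add_neg] using hx.add hj hy.neg_one_smul

/-- Convergence is inherited by a second family of bounded connecting maps whose basic nets
differ from those of the first by null nets. -/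
theorem of_isNullNet_sub {j' : ∀ n m : N, E m →L[ℂ] E n}
    (hbdd : ∀ (m : N) (ξ : E m), UniformlyBounded (fun n => j n m ξ))
    (hnull : ∀ (m : N) (ξ : E m), IsNullNet (fun n => j n m ξ - j' n m ξ))
    {x : ∀ n, E n} (hx : JConvergent j x) : JConvergent j' x := by
  refine ⟨hx.1, fun ε hε => ?_⟩
  have hε' : 0 < ε / 3 := by positivity
  obtain ⟨m, ξ, hξ⟩ := hx.2 _ hε'
  refine ⟨m, ξ, lt_of_le_of_lt (netSeminorm_le (ε := 2 * (ε / 3)) ?_) (by linarith)⟩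
  filter_upwards [(hx.1.sub (hbdd m ξ)).eventually_norm_lt hξ,
    (hnull m ξ).eventually_lt_const hε'] with n h₁ h₂
  have := norm_sub_le_norm_sub_add_norm_sub (x n) (j n m ξ) (j' n m ξ)
  linarith

end JConvergent

namespace IsLimitSpace

variable {j : ∀ n m : N, E m →L[ℂ] E n} {G : Type*} [NormedAddCommGroup G] [NormedSpace ℂ G]
  {L : (∀ n, E n) → G}

theorem map_sub (hL : IsLimitSpace j G L) (hj : IsSoftInductiveSystem j) {x y : ∀ n, E n}
    (hx : JConvergent j x) (hy : JConvergent j y) : L (x - y) = L x - L y := by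
  have h := hL.map_add _ _ (hx.sub hj hy) hy
  rw [sub_add_cancel] at h
  exact eq_sub_of_add_eq h.symm

theorem norm_map_sub (hL : IsLimitSpace j G L) (hj : IsSoftInductiveSystem j) {x y : ∀ n, E n}
    (hx : JConvergent j x) (hy : JConvergent j y) : ‖L x - L y‖ = netSeminorm (x - y) := by
  rw [← hL.map_sub hj hx hy, hL.norm_eq _ (hx.sub hj hy)]

theorem isNullNet_sub (hL : IsLimitSpace j G L) (hj : IsSoftInductiveSystem j)
    {x y : ∀ n, E n} (hx : JConvergent j x) (hy : JConvergent j y) (h : L x = L y) :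
    IsNullNet (x - y) :=
  (hx.sub hj hy).1.isNullNet (by rw [← hL.norm_map_sub hj hx hy, h, sub_self, norm_zero])

theorem norm_map_basicNet_sub_le (hL : IsLimitSpace j G L) (hj : IsSoftInductiveSystem j)
    (m : N) (ξ η : E m) : ‖L (basicNet j m ξ) - L (basicNet j m η)‖ ≤ ‖ξ - η‖ := by
  rw [hL.norm_map_sub hj (.basicNet hj m ξ) (.basicNet hj m η)]
  refine netSeminorm_le (Eventually.of_forall fun n => ?_)
  simpa [basicNet] using hj.norm_map_le n m (ξ - η)

theorem norm_map_basicNet_le (hL : IsLimitSpace j G L) (hj : IsSoftInductiveSystem j)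
    (m : N) (ξ : E m) : ‖L (basicNet j m ξ)‖ ≤ ‖ξ‖ := by
  rw [hL.norm_eq _ (.basicNet hj m ξ)]
  exact netSeminorm_le (Eventually.of_forall fun n => hj.norm_map_le n m ξ)

/-- If a convergent net `x` has the same limit as the basic net of `ξ`, then the limits
`j_{∞ m} (x m)` converge to this limit. -/
theorem tendsto_norm_map_basicNet_sub (hL : IsLimitSpace j G L) (hj : IsSoftInductiveSystem j)
    {x : ∀ n, E n} (hx : JConvergent j x) {l : N} {ξ : E l} (h : L x = L (basicNet j l ξ)) :
    Tendsto (fun m => ‖L (basicNet j l ξ) - L (basicNet j m (x m))‖) atTop (𝓝 0) := by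
  have hnull := hL.isNullNet_sub hj (.basicNet hj l ξ) hx h.symm
  have hlim := (hj.soft l ξ).add hnull
  rw [add_zero] at hlim
  refine squeeze_zero (fun _ => norm_nonneg _) (fun m => ?_) hlim
  refine (norm_sub_le_norm_sub_add_norm_sub _ (L (basicNet j m (j m l ξ))) _).trans ?_
  exact add_le_add (hL.norm_map_sub hj (.basicNet hj l ξ) (.basicNet hj m _)).le
    (hL.norm_map_basicNet_sub_le hj m _ _)

end IsLimitSpace

end Auxiliary

/-- Let `(E,j,s)` be a split inductive system: `s : E_∞ → C(E,j)` is
a linear contraction which is a right inverse of `j-lim` (the limit space being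
realized by `(G, L)`). Define `j' n m ξ := s (j_{∞ m} ξ) n`. Then `(E,j')` is a soft
inductive system (the `j' n m` are contractions satisfying the soft compatibility
condition), `j`-convergence and `j'`-convergence coincide, and the `j'`-maps satisfy
the stronger uniform condition `lim_m sup_n ‖(j' n l - j' n m ∘ j' m l) ξ‖ = 0`. -/
theorem split_system (j : ∀ n m : N, E m →L[ℂ] E n)
    (hj : IsSoftInductiveSystem j)
    {G : Type*} [NormedAddCommGroup G] [NormedSpace ℂ G] [CompleteSpace G]
    (L : (∀ n, E n) → G) (hL : IsLimitSpace j G L)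
    (s : G → ∀ n, E n)
    (hsconv : ∀ g : G, JConvergent j (s g))
    (hsadd : ∀ g h : G, s (g + h) = s g + s h)
    (hssmul : ∀ (c : ℂ) (g : G), s (c • g) = c • s g)
    (hsbound : ∀ (g : G) (n : N), ‖s g n‖ ≤ ‖g‖)
    (hsec : ∀ g : G, L (s g) = g)
    (j' : ∀ n m : N, E m →L[ℂ] E n)
    (hj' : ∀ (n m : N) (ξ : E m), j' n m ξ = s (L (basicNet j m ξ)) n) :
    (∀ (n m : N) (ξ : E m), ‖j' n m ξ‖ ≤ ‖ξ‖) ∧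
    (∀ (l : N) (ξ : E l), Tendsto
        (fun m => limsup (fun n => ‖j' n l ξ - j' n m (j' m l ξ)‖) atTop)
        atTop (𝓝 0)) ∧
    (∀ x : ∀ n, E n, JConvergent j x ↔ JConvergent j' x) ∧
    (∀ (l : N) (ξ : E l), Tendsto
        (fun m => ⨆ n, ‖j' n l ξ - j' n m (j' m l ξ)‖) atTop (𝓝 0)) := by
  have hssub (g h : G) : s (g - h) = s g - s h := by
    have := hsadd (g - h) h
    rw [sub_add_cancel] at this
    exact eq_sub_of_add_eq this.symm
  have hcontr (n m : N) (ξ : E m) : ‖j' n m ξ‖ ≤ ‖ξ‖ := by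
    rw [hj']
    exact (hsbound _ n).trans (hL.norm_map_basicNet_le hj m ξ)
  have hnull (m : N) (ξ : E m) : IsNullNet (fun n => j n m ξ - j' n m ξ) := by
    simp only [hj']
    exact hL.isNullNet_sub hj (.basicNet hj m ξ) (hsconv _) (hsec _).symm
  have hnull' (m : N) (ξ : E m) : IsNullNet (fun n => j' n m ξ - j n m ξ) := by
    simpa only [IsNullNet, norm_sub_rev] using hnull m ξ
  have hlim (l : N) (ξ : E l) :=
    hL.tendsto_norm_map_basicNet_sub hj (hsconv _) (hsec (L (basicNet j l ξ)))
  have hle (l m n : N) (ξ : E l) : ‖j' n l ξ - j' n m (j' m l ξ)‖ ≤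
      ‖L (basicNet j l ξ) - L (basicNet j m (s (L (basicNet j l ξ)) m))‖ := by
    rw [hj' n m, hj' n l, hj' m l, ← Pi.sub_apply, ← hssub]
    exact hsbound _ n
  have hbdd (l m : N) (ξ : E l) : UniformlyBounded (fun n => j' n l ξ - j' n m (j' m l ξ)) :=
    ⟨_, fun n => hle l m n ξ⟩
  refine ⟨hcontr, fun l ξ => ?_, fun x => ⟨?_, ?_⟩, fun l ξ => ?_⟩
  · exact squeeze_zero (fun m => (hbdd l m ξ).netSeminorm_nonneg)
      (fun m => netSeminorm_le (Eventually.of_forall fun n => hle l m n ξ)) (hlim l ξ)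
  · exact JConvergent.of_isNullNet_sub (fun m ξ => ⟨_, fun n => hj.norm_map_le n m ξ⟩) hnull
  · exact JConvergent.of_isNullNet_sub (fun m ξ => ⟨_, fun n => hcontr n m ξ⟩) hnull'
  · exact squeeze_zero (fun m => Real.iSup_nonneg fun n => norm_nonneg _)
      (fun m => ciSup_le fun n => hle l m n ξ) (hlim l ξ)
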